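/- Let 1 ≤ p < 2 < q ≤ ∞ and θ ∈ (0,1) satisfy 1/2 = θ/p + (1-θ)/q. Then there exists a constant C > 0 such that for every w̃ ∈ L^p(ℝ²) ∩ L^q(ℝ²), the Biot–Savart velocity field v = K * w̃ satisfies ‖v‖_{L^∞(ℝ²)} ≤ C ‖w̃‖_{L^p}^θ ‖w̃‖_{L^q}^{1-θ}. -/

import Mathlib

open MeasureTheory Real ENNReal

noncomputable section

abbrev E2 := EuclideanSpace ℝ (Fin 2)

/-- `x^⊥ = (-x₂, x₁)`. -/
def perp (x : E2) : E2 := (WithLp.equiv 2 (Fin 2 → ℝ)).symm ![-x 1, x 0]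

/-- The Biot–Savart velocity field of a scalar function `w` on `ℝ²`. -/
def biotSavart (w : E2 → ℝ) (x : E2) : E2 :=
  ∫ y, ((2 * π * ‖x - y‖ ^ 2)⁻¹ * w y) • perp (x - y)

lemma norm_perp (x : E2) : ‖perp x‖ = ‖x‖ := by
  simp [perp, EuclideanSpace.norm_eq, Fin.sum_univ_two, add_comm]

lemma memLp_inv_norm_indicator_ball {s : ℝ≥0∞} (hs0 : s ≠ 0) (hs : s < 2) :
    MemLp ((Metric.ball (0 : E2) 1).indicator fun z ↦ ‖z‖⁻¹) s volume := by
  have hst : s ≠ ⊤ := (hs.trans (by simp)).ne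
  have hr : s.toReal < 2 := by
    simpa using (ENNReal.toReal_lt_toReal hst (by simp)).2 hs
  rw [memLp_indicator_iff_restrict Metric.isOpen_ball.measurableSet,
    ← integrable_norm_rpow_iff (by fun_prop) hs0 hst]
  have h := (integrableOn_fun_norm_addHaar (E := E2) volume
    (f := fun t : ℝ ↦ ‖t⁻¹‖ ^ s.toReal) (r := 1)).2 ?_
  · exact h
  · have h1 := (intervalIntegral.integrableOn_Ioo_rpow_iff (s := 1 - s.toReal) (t := 1) one_pos).2
      (by linarith)
    refine h1.congr_fun (fun t ht ↦ ?_) measurableSet_Ioo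
    have ht0 : 0 < t := ht.1
    simp only [finrank_euclideanSpace, Fintype.card_fin, Nat.add_one_sub_one, pow_one, smul_eq_mul,
      Real.norm_eq_abs, abs_inv, abs_of_pos ht0]
    rw [Real.rpow_sub ht0, Real.rpow_one, Real.inv_rpow ht0.le, div_eq_mul_inv]

lemma memLp_inv_norm_indicator_compl_ball {s : ℝ≥0∞} (hs : 2 < s) :
    MemLp ((Metric.ball (0 : E2) 1)ᶜ.indicator fun z ↦ ‖z‖⁻¹) s volume := by
  have key : MemLp (fun z : E2 ↦ 2 * (1 + ‖z‖)⁻¹) s volume := by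
    refine MemLp.const_mul ?_ 2
    by_cases hst : s = ⊤
    · subst hst
      refine memLp_top_of_bound (by fun_prop) 1 (.of_forall fun z ↦ ?_)
      rw [norm_inv, Real.norm_of_nonneg (by positivity)]
      exact inv_le_one_of_one_le₀ (by linarith [norm_nonneg z])
    · have hr : 2 < s.toReal := by
        simpa using (ENNReal.toReal_lt_toReal (by simp) hst).2 hs
      rw [← integrable_norm_rpow_iff (by fun_prop) (by rintro rfl; simp at hs) hst]
      refine (integrable_one_add_norm (E := E2) (μ := volume) (r := s.toReal)
        (by simpa using hr)).congr (.of_forall fun z ↦ ?_)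
      have hz : 0 ≤ 1 + ‖z‖ := by positivity
      simp only [norm_inv, Real.norm_of_nonneg hz]
      rw [Real.rpow_neg hz, Real.inv_rpow hz]
  refine key.mono ?_ (.of_forall fun z ↦ ?_)
  · exact (Measurable.indicator (by fun_prop)
      Metric.isOpen_ball.measurableSet.compl).aestronglyMeasurable
  · by_cases hz : z ∈ (Metric.ball (0 : E2) 1)ᶜ
    · have h1 : 1 ≤ ‖z‖ := by simpa using hz
      rw [Set.indicator_of_mem hz, Real.norm_of_nonneg (by positivity),
        Real.norm_of_nonneg (by positivity), ← div_eq_mul_inv, inv_eq_one_div,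
        div_le_div_iff₀ (by positivity) (by positivity)]
      linarith
    · rw [Set.indicator_of_notMem hz, norm_zero]
      positivity

/-- Hölder's inequality for a kernel in the conjugate Lebesgue space. -/
lemma exists_lintegral_mul_le {f : E2 → ℝ} {s t : ℝ≥0∞} [ENNReal.HolderConjugate s t]
    (hf : MemLp f t volume) :
    ∃ C : ℝ, 0 ≤ C ∧ ∀ u : E2 → ℝ, MemLp u s volume →
      ∫⁻ z, ‖f z * u z‖ₑ ≤ ENNReal.ofReal C * eLpNorm u s volume := by
  have : ENNReal.HolderConjugate t s := .symm
  refine ⟨(eLpNorm f t volume).toReal, ENNReal.toReal_nonneg, fun u hu ↦ ?_⟩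
  rw [ENNReal.ofReal_toReal hf.2.ne]
  have := eLpNorm_smul_le_mul_eLpNorm (p := t) (q := s) (r := 1) hu.1 hf.1
  rwa [eLpNorm_one_eq_lintegral_enorm] at this

lemma two_lt_conjugate {s : ℝ≥0∞} (hs1 : 1 ≤ s) (hs : s < 2) : 2 < (1 - s⁻¹)⁻¹ := by
  rw [ENNReal.lt_inv_iff_lt_inv]
  have h : (2 : ℝ≥0∞)⁻¹ < s⁻¹ := ENNReal.inv_lt_inv.2 hs
  refine ENNReal.sub_lt_of_lt_add (by simpa using hs1) ?_
  calc (1 : ℝ≥0∞) = 2⁻¹ + 2⁻¹ := ENNReal.inv_two_add_inv_two.symm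
    _ < 2⁻¹ + s⁻¹ := ENNReal.add_lt_add_left (by simp) h

lemma conjugate_lt_two {s : ℝ≥0∞} (hs : 2 < s) : (1 - s⁻¹)⁻¹ < 2 := by
  rw [ENNReal.inv_lt_iff_inv_lt]
  have h : s⁻¹ < (2 : ℝ≥0∞)⁻¹ := ENNReal.inv_lt_inv.2 hs
  rw [lt_tsub_iff_right]
  calc (2 : ℝ≥0∞)⁻¹ + s⁻¹ < 2⁻¹ + 2⁻¹ := ENNReal.add_lt_add_left (by simp) h
    _ = 1 := ENNReal.inv_two_add_inv_two

/-- The Riesz-type integral `∫ |u(z)| / |z| dz` is controlled by the sum of the norms. -/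
lemma exists_lintegral_inv_norm_mul_le {p q : ℝ≥0∞} (hp1 : 1 ≤ p) (hp2 : p < 2) (hq : 2 < q) :
    ∃ C : ℝ, 0 < C ∧ ∀ u : E2 → ℝ, MemLp u p volume → MemLp u q volume →
      ∫⁻ z, ‖‖z‖⁻¹ * u z‖ₑ ≤ ENNReal.ofReal C * (eLpNorm u p volume + eLpNorm u q volume) := by
  have hcp := ENNReal.HolderConjugate.inv_one_sub_inv' hp1
  have hcq := ENNReal.HolderConjugate.inv_one_sub_inv' (one_le_two.trans hq.le)
  obtain ⟨C₁, hC₁, h₁⟩ := exists_lintegral_mul_le (s := p)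
    (memLp_inv_norm_indicator_compl_ball (two_lt_conjugate hp1 hp2))
  obtain ⟨C₂, hC₂, h₂⟩ := exists_lintegral_mul_le (s := q)
    (memLp_inv_norm_indicator_ball (by simp) (conjugate_lt_two hq))
  refine ⟨C₁ + C₂ + 1, by positivity, fun u hup huq ↦ ?_⟩
  set B := Metric.ball (0 : E2) 1
  have hB : MeasurableSet B := Metric.isOpen_ball.measurableSet
  calc ∫⁻ z, ‖‖z‖⁻¹ * u z‖ₑ
      ≤ ∫⁻ z, (‖Bᶜ.indicator (fun z ↦ ‖z‖⁻¹) z * u z‖ₑ + ‖B.indicator (fun z ↦ ‖z‖⁻¹) z * u z‖ₑ) :=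
        lintegral_mono fun z ↦ by by_cases hz : z ∈ B <;> simp [hz]
    _ = (∫⁻ z, ‖Bᶜ.indicator (fun z ↦ ‖z‖⁻¹) z * u z‖ₑ)
          + ∫⁻ z, ‖B.indicator (fun z ↦ ‖z‖⁻¹) z * u z‖ₑ := by
        refine lintegral_add_left' (AEMeasurable.enorm (AEMeasurable.mul ?_ hup.1.aemeasurable)) _
        exact (Measurable.indicator (by fun_prop) hB.compl).aemeasurable
    _ ≤ ENNReal.ofReal C₁ * eLpNorm u p volume + ENNReal.ofReal C₂ * eLpNorm u q volume :=
        add_le_add (h₁ u hup) (h₂ u huq)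
    _ ≤ ENNReal.ofReal (C₁ + C₂ + 1) * (eLpNorm u p volume + eLpNorm u q volume) := by
        rw [mul_add]
        gcongr <;> linarith

lemma map_smul_volume {R : ℝ} (hR : 0 < R) :
    Measure.map (fun z : E2 ↦ R • z) volume = ENNReal.ofReal (R ^ (-2 : ℝ)) • volume := by
  rw [Measure.map_addHaar_smul volume hR.ne', abs_of_pos (by positivity)]
  simp [Real.rpow_neg hR.le]

lemma measurableEmbedding_smul {R : ℝ} (hR : 0 < R) :
    MeasurableEmbedding (fun z : E2 ↦ R • z) :=
  (Homeomorph.smulOfNeZero R hR.ne').measurableEmbedding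

lemma eLpNorm_comp_smul_left (u : E2 → ℝ) (s : ℝ≥0∞) {R : ℝ} (hR : 0 < R) :
    eLpNorm (fun z ↦ u (R • z)) s volume
      = ENNReal.ofReal (R ^ (-2 * (1 / s).toReal)) * eLpNorm u s volume := by
  have h := (measurableEmbedding_smul hR).eLpNorm_map_measure (g := u) (p := s) (μ := volume)
  rw [map_smul_volume hR, eLpNorm_smul_measure_of_ne_zero
    (ENNReal.ofReal_pos.2 (Real.rpow_pos_of_pos hR _)).ne'] at h
  rw [Real.rpow_mul hR.le, ← ENNReal.ofReal_rpow_of_pos (Real.rpow_pos_of_pos hR _)]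
  exact h.symm

lemma memLp_comp_smul_left {u : E2 → ℝ} {s : ℝ≥0∞} {R : ℝ} (hR : 0 < R)
    (hu : MemLp u s volume) : MemLp (fun z ↦ u (R • z)) s volume := by
  refine MemLp.comp_of_map (g := u) (f := fun z ↦ R • z) ?_ (by fun_prop)
  rw [map_smul_volume hR]
  exact hu.smul_measure ENNReal.ofReal_ne_top

lemma lintegral_inv_norm_mul_eq (u : E2 → ℝ) {R : ℝ} (hR : 0 < R) :
    ∫⁻ z, ‖‖z‖⁻¹ * u z‖ₑ = ENNReal.ofReal R * ∫⁻ z, ‖‖z‖⁻¹ * u (R • z)‖ₑ := by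
  have h := (measurableEmbedding_smul hR).lintegral_map (μ := volume)
    (fun z ↦ ‖‖z‖⁻¹ * u z‖ₑ)
  rw [map_smul_volume hR, lintegral_smul_measure] at h
  have h2 : ∫⁻ z : E2, ‖‖R • z‖⁻¹ * u (R • z)‖ₑ
      = ENNReal.ofReal R⁻¹ * ∫⁻ z, ‖‖z‖⁻¹ * u (R • z)‖ₑ := by
    rw [← lintegral_const_mul' _ _ ENNReal.ofReal_ne_top]
    refine lintegral_congr fun z ↦ ?_
    rw [norm_smul, Real.norm_of_nonneg hR.le, mul_inv, mul_assoc, enorm_mul R⁻¹,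
      Real.enorm_of_nonneg (by positivity : 0 ≤ R⁻¹)]
  rw [h2, smul_eq_mul] at h
  have h3 : ∀ J : ℝ≥0∞, J = ENNReal.ofReal (R ^ 2) * (ENNReal.ofReal (R ^ (-2 : ℝ)) * J) := by
    intro J
    rw [← mul_assoc, ← ENNReal.ofReal_mul (by positivity), Real.rpow_neg hR.le, Real.rpow_two,
      mul_inv_cancel₀ (by positivity), ENNReal.ofReal_one, one_mul]
  rw [h3 (∫⁻ z, ‖‖z‖⁻¹ * u z‖ₑ), h, ← mul_assoc, ← ENNReal.ofReal_mul (by positivity)]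
  congr 2
  field_simp

lemma exists_lintegral_inv_norm_mul_le_rpow {p q : ℝ≥0∞} (hp1 : 1 ≤ p) (hp2 : p < 2)
    (hq : 2 < q) :
    ∃ C : ℝ, 0 < C ∧ ∀ u : E2 → ℝ, MemLp u p volume → MemLp u q volume → ∀ R : ℝ, 0 < R →
      ∫⁻ z, ‖‖z‖⁻¹ * u z‖ₑ ≤ ENNReal.ofReal C *
        (ENNReal.ofReal (R ^ (1 - 2 * (1 / p).toReal)) * eLpNorm u p volume
          + ENNReal.ofReal (R ^ (1 - 2 * (1 / q).toReal)) * eLpNorm u q volume) := by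
  obtain ⟨C, hC, h⟩ := exists_lintegral_inv_norm_mul_le hp1 hp2 hq
  refine ⟨C, hC, fun u hup huq R hR ↦ ?_⟩
  have hpow (e : ℝ) : ENNReal.ofReal (R ^ (1 - 2 * e))
      = ENNReal.ofReal R * ENNReal.ofReal (R ^ (-2 * e)) := by
    rw [← ENNReal.ofReal_mul hR.le, sub_eq_add_neg, Real.rpow_add hR, Real.rpow_one, neg_mul]
  calc ∫⁻ z, ‖‖z‖⁻¹ * u z‖ₑ
      ≤ ENNReal.ofReal R * (ENNReal.ofReal C *
          (eLpNorm (fun z ↦ u (R • z)) p volume + eLpNorm (fun z ↦ u (R • z)) q volume)) := by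
        rw [lintegral_inv_norm_mul_eq u hR]
        gcongr
        exact h _ (memLp_comp_smul_left hR hup) (memLp_comp_smul_left hR huq)
    _ = _ := by
        rw [eLpNorm_comp_smul_left u p hR, eLpNorm_comp_smul_left u q hR, hpow, hpow]
        ring

/-- Balancing `R ^ (-α) * a` against `R ^ β * b`. -/
lemma exists_rpow_balance {a b α β θ : ℝ} (ha : 0 < a) (hb : 0 < b) (hα : 0 < α) (hβ : 0 < β)
    (hθ : θ * α = (1 - θ) * β) :
    ∃ R : ℝ, 0 < R ∧ R ^ (-α) * a = a ^ θ * b ^ (1 - θ) ∧ R ^ β * b = a ^ θ * b ^ (1 - θ) := by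
  have hθ' : θ = β / (α + β) := by
    rw [_root_.eq_div_iff (by positivity)]; linarith
  refine ⟨Real.exp ((Real.log a - Real.log b) / (α + β)), Real.exp_pos _, ?_, ?_⟩
  · rw [← Real.exp_mul]
    conv_lhs => rw [← Real.exp_log ha]
    rw [Real.rpow_def_of_pos ha, Real.rpow_def_of_pos hb, ← Real.exp_add, ← Real.exp_add,
      Real.log_exp, hθ']
    congr 1
    field_simp
    ring
  · rw [← Real.exp_mul]
    conv_lhs => rw [← Real.exp_log hb]
    rw [Real.rpow_def_of_pos ha, Real.rpow_def_of_pos hb, ← Real.exp_add, ← Real.exp_add,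
      Real.log_exp, hθ']
    congr 1
    field_simp
    ring

lemma enorm_biotSavart_le (w : E2 → ℝ) (x : E2) :
    ‖biotSavart w x‖ₑ ≤ ∫⁻ z, ‖‖z‖⁻¹ * w (x - z)‖ₑ := by
  rw [← lintegral_sub_left_eq_self (fun z ↦ ‖‖z‖⁻¹ * w (x - z)‖ₑ) x]
  refine (enorm_integral_le_lintegral_enorm _).trans (lintegral_mono fun y ↦ ?_)
  rw [enorm_le_iff_norm_le, _root_.sub_sub_cancel, norm_smul, norm_perp, norm_mul, norm_mul,
    Real.norm_of_nonneg (by positivity : 0 ≤ (2 * π * ‖x - y‖ ^ 2)⁻¹),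
    Real.norm_of_nonneg (by positivity : 0 ≤ ‖x - y‖⁻¹)]
  rcases eq_or_ne ‖x - y‖ 0 with h | h
  · simp [h]
  · have hπ : (2 * π)⁻¹ ≤ 1 := inv_le_one_of_one_le₀ (by linarith [Real.pi_gt_three])
    calc (2 * π * ‖x - y‖ ^ 2)⁻¹ * ‖w y‖ * ‖x - y‖
        = (2 * π)⁻¹ * (‖x - y‖⁻¹ * ‖w y‖) := by field_simp
      _ ≤ 1 * (‖x - y‖⁻¹ * ‖w y‖) := by gcongr
      _ = _ := one_mul _

/-- Lemma 2.1 (ii): interpolation bound `‖v‖_∞ ≤ C ‖w‖_p^θ ‖w‖_q^{1-θ}` when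
`1 ≤ p < 2 < q ≤ ∞` and `1/2 = θ/p + (1-θ)/q`. -/
theorem biotSavart_Linfty_interpolation (p : ℝ) (q : ℝ≥0∞) (θ : ℝ)
    (hp1 : 1 ≤ p) (hp2 : p < 2) (hq : 2 < q) (hθ1 : 0 < θ) (hθ2 : θ < 1)
    (hpq : (1 : ℝ) / 2 = θ / p + (1 - θ) * (1 / q).toReal) :
    ∃ C : ℝ, 0 < C ∧ ∀ w : E2 → ℝ,
      MemLp w (ENNReal.ofReal p) volume → MemLp w q volume →
      eLpNorm (biotSavart w) ⊤ volume
        ≤ ENNReal.ofReal C * eLpNorm w (ENNReal.ofReal p) volume ^ θ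
            * eLpNorm w q volume ^ (1 - θ) := by
  have hp0 : 0 < p := by linarith
  have hP1 : 1 ≤ ENNReal.ofReal p := by simpa using hp1
  have hP2 : ENNReal.ofReal p < 2 := by
    simpa using (ENNReal.ofReal_lt_ofReal_iff (by norm_num : (0 : ℝ) < 2)).2 hp2
  obtain ⟨C, hC, hI⟩ := exists_lintegral_inv_norm_mul_le_rpow hP1 hP2 hq
  have hPinv : (1 / ENNReal.ofReal p).toReal = 1 / p := by
    simp [ENNReal.toReal_ofReal hp0.le]
  rw [hPinv] at hI
  have hα : 0 < 2 * (1 / p) - 1 := by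
    rw [sub_pos, mul_one_div, lt_div_iff₀ hp0]; linarith
  have hβ : 0 < 1 - 2 * (1 / q).toReal := by
    have : (1 / q).toReal < 2⁻¹ := by
      have := (ENNReal.toReal_lt_toReal (a := 1 / q) (b := 2⁻¹)
        (by simp [(pos_of_gt hq).ne']) (by simp)).2
        (by rw [one_div]; exact ENNReal.inv_lt_inv.2 hq)
      simpa using this
    linarith
  refine ⟨C * 2, by positivity, fun w hwp hwq ↦ ?_⟩
  rw [eLpNorm_exponent_top]
  refine eLpNormEssSup_le_of_ae_enorm_bound (.of_forall fun x ↦ ?_)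
  refine (enorm_biotSavart_le w x).trans ?_
  have hmp := Measure.measurePreserving_sub_left (volume : Measure E2) x
  have hbound := hI (fun z ↦ w (x - z)) (hwp.comp_measurePreserving hmp)
    (hwq.comp_measurePreserving hmp)
  have hnp := eLpNorm_comp_measurePreserving (p := ENNReal.ofReal p) hwp.1 hmp
  have hnq := eLpNorm_comp_measurePreserving (p := q) hwq.1 hmp
  simp only [Function.comp_def] at hnp hnq
  rw [hnp, hnq] at hbound
  by_cases hw : w =ᵐ[volume] 0
  · have h0 := hbound 1 one_pos
    simp only [eLpNorm_congr_ae hw, eLpNorm_zero, mul_zero, add_zero] at h0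
    exact h0.trans zero_le
  have hA0 : eLpNorm w (ENNReal.ofReal p) volume ≠ 0 := by
    rwa [Ne, eLpNorm_eq_zero_iff hwp.1 (by simpa using hp0)]
  have hB0 : eLpNorm w q volume ≠ 0 := by
    rwa [Ne, eLpNorm_eq_zero_iff hwq.1 (pos_of_gt hq).ne']
  have ha := ENNReal.toReal_pos hA0 hwp.2.ne
  have hb := ENNReal.toReal_pos hB0 hwq.2.ne
  rw [← ENNReal.ofReal_toReal hwp.2.ne, ← ENNReal.ofReal_toReal hwq.2.ne] at hbound ⊢
  set a := (eLpNorm w (ENNReal.ofReal p) volume).toReal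
  set b := (eLpNorm w q volume).toReal
  obtain ⟨R, hR, h1, h2⟩ := exists_rpow_balance (θ := θ) ha hb hα hβ (by
    rw [div_eq_mul_one_div θ p] at hpq; linarith)
  rw [neg_sub] at h1
  refine (hbound R hR).trans_eq ?_
  rw [← ENNReal.ofReal_mul (by positivity), ← ENNReal.ofReal_mul (by positivity), h1, h2,
    ENNReal.ofReal_rpow_of_pos ha, ENNReal.ofReal_rpow_of_pos hb,
    ← ENNReal.ofReal_add (by positivity) (by positivity), ← ENNReal.ofReal_mul hC.le,
    ← ENNReal.ofReal_mul (by positivity), ← ENNReal.ofReal_mul (by positivity)]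
  congr 1
  ring
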